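/- Every nonzero two-sided ideal of R contains F. -/

import Mathlib

/-!
`R = k⟨x,y⟩/⟨yx − 1⟩` is the associative `k`-algebra generated by `x` and `y`
with the single defining relation `y * x = 1` (the one-sided inverse of `k[x]`).
We realize it as the `RingQuot` of the free algebra on two generators.
-/

noncomputable section

/-- The defining relation `y * x = 1` on the free algebra `k⟨x,y⟩`. -/
inductive PreRel (k : Type) [Field k] : FreeAlgebra k (Fin 2) → FreeAlgebra k (Fin 2) → Prop
  | yx : PreRel k (FreeAlgebra.ι k 1 * FreeAlgebra.ι k 0) 1

/-- `R = k⟨x,y⟩/⟨yx − 1⟩`. -/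
abbrev R (k : Type) [Field k] := RingQuot (PreRel k)

/-- The generator `x` of `R`. -/
def Xg (k : Type) [Field k] : R k := RingQuot.mkAlgHom k (PreRel k) (FreeAlgebra.ι k 0)

/-- The generator `y` of `R`. -/
def Yg (k : Type) [Field k] : R k := RingQuot.mkAlgHom k (PreRel k) (FreeAlgebra.ι k 1)

/-- `F = ⟨1 − xy⟩`, the two-sided ideal of `R` generated by `1 − xy`. -/
def Fideal (k : Type) [Field k] : TwoSidedIdeal (R k) :=
  TwoSidedIdeal.span {1 - Xg k * Yg k}

theorem Yg_mul_Xg (k : Type) [Field k] : Yg k * Xg k = 1 := by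
  unfold Xg Yg
  rw [← map_mul, RingQuot.mkAlgHom_rel k (PreRel.yx (k := k)), map_one]

theorem Yg_pow_mul_Xg_pow (k : Type) [Field k] (n : ℕ) : Yg k ^ n * Xg k ^ n = 1 := by
  induction n with
  | zero => simp
  | succ n ih =>
    rw [pow_succ, pow_succ', mul_assoc, ← mul_assoc (Yg k) (Xg k), Yg_mul_Xg, one_mul, ih]

theorem Yg_mul_e (k : Type) [Field k] : Yg k * (1 - Xg k * Yg k) = 0 := by
  rw [mul_sub, ← mul_assoc, Yg_mul_Xg]; simp

/-- If `m < n` then `y ^ n * x ^ m * e = 0`. -/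
theorem pow_kill (k : Type) [Field k] {m n : ℕ} (h : m < n) :
    Yg k ^ n * (Xg k ^ m * (1 - Xg k * Yg k)) = 0 := by
  obtain ⟨d, rfl⟩ := Nat.exists_eq_add_of_lt h
  have : Yg k ^ (m + d + 1) = Yg k ^ d * Yg k * Yg k ^ m := by
    rw [← pow_succ, ← pow_add]; congr 1; omega
  rw [this, mul_assoc, ← mul_assoc (Yg k ^ m), Yg_pow_mul_Xg_pow, one_mul, mul_assoc,
    Yg_mul_e, mul_zero]

theorem pow_keep (k : Type) [Field k] (m : ℕ) :
    Yg k ^ m * (Xg k ^ m * (1 - Xg k * Yg k)) = 1 - Xg k * Yg k := by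
  rw [← mul_assoc, Yg_pow_mul_Xg_pow, one_mul]

/-- The monomials `x ^ i * y ^ j`. -/
def mon (k : Type) [Field k] (p : ℕ × ℕ) : R k := Xg k ^ p.1 * Yg k ^ p.2

theorem mul_mem_span (k : Type) [Field k] (f : FreeAlgebra k (Fin 2)) :
    ∀ w ∈ Submodule.span k (Set.range (mon k)),
      RingQuot.mkAlgHom k (PreRel k) f * w ∈ Submodule.span k (Set.range (mon k)) := by
  induction f using FreeAlgebra.induction with
  | grade0 r =>
    intro w hw
    rw [AlgHom.commutes, ← Algebra.smul_def]
    exact Submodule.smul_mem _ _ hw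
  | grade1 i =>
    intro w hw
    induction hw using Submodule.span_induction with
    | zero => simp
    | add a b _ _ ha hb => rw [mul_add]; exact Submodule.add_mem _ ha hb
    | smul c a _ ha => rw [mul_smul_comm]; exact Submodule.smul_mem _ _ ha
    | mem a ha =>
      obtain ⟨⟨p, q⟩, rfl⟩ := ha
      apply Submodule.subset_span
      fin_cases i
      · refine ⟨(p + 1, q), ?_⟩
        change Xg k ^ (p + 1) * Yg k ^ q = Xg k * (Xg k ^ p * Yg k ^ q)
        rw [pow_succ', mul_assoc]
      · change Yg k * (Xg k ^ p * Yg k ^ q) ∈ _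
        cases p with
        | zero =>
          refine ⟨(0, q + 1), ?_⟩
          simp [mon, pow_succ']
        | succ p =>
          refine ⟨(p, q), ?_⟩
          rw [pow_succ', mul_assoc, ← mul_assoc (Yg k), Yg_mul_Xg, one_mul, mon]
  | mul a b ha hb =>
    intro w hw
    rw [map_mul, mul_assoc]
    exact ha _ (hb _ hw)
  | add a b ha hb =>
    intro w hw
    rw [map_add, add_mul]
    exact Submodule.add_mem _ (ha _ hw) (hb _ hw)

theorem mem_span_mon (k : Type) [Field k] (a : R k) :
    a ∈ Submodule.span k (Set.range (mon k)) := by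
  obtain ⟨f, rfl⟩ := RingQuot.mkAlgHom_surjective k (PreRel k) a
  have := mul_mem_span k f 1 (Submodule.subset_span ⟨(0, 0), by simp [mon]⟩)
  simpa using this

/-- every nonzero two-sided ideal of `R` contains `F`. -/
theorem F_le_of_ne_bot (k : Type) [Field k] (I : TwoSidedIdeal (R k)) (hI : I ≠ ⊥) :
    Fideal k ≤ I := by
  have hex : ∃ a ∈ I, a ≠ 0 := by
    by_contra! h
    apply hI
    rw [eq_bot_iff]
    intro a ha
    rw [h a ha]
    exact TwoSidedIdeal.zero_mem _
  obtain ⟨a, haI, ha0⟩ := hex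
  obtain ⟨c, hc⟩ := (Finsupp.mem_span_range_iff_exists_finsupp).1 (mem_span_mon k a)
  have hne : c.support.Nonempty := by
    rw [Finsupp.support_nonempty_iff]
    rintro rfl
    exact ha0 (by simpa using hc.symm)
  obtain ⟨p, hp, hpmin⟩ := Finset.exists_min_image c.support Prod.snd hne
  obtain ⟨q, hq, hqmax⟩ := Finset.exists_max_image (c.support.filter fun r => r.2 = p.2) Prod.fst
    ⟨p, by simpa using hp⟩
  rw [Finset.mem_filter] at hq
  have key : Yg k ^ q.1 * a * (Xg k ^ q.2 * (1 - Xg k * Yg k)) = c q • (1 - Xg k * Yg k) := by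
    rw [← hc, Finsupp.sum, Finset.mul_sum, Finset.sum_mul, Finset.sum_eq_single q]
    · rw [mul_smul_comm, smul_mul_assoc, mon, mul_assoc, mul_assoc, pow_keep, pow_keep]
    · intro r hr hrq
      rw [mul_smul_comm, smul_mul_assoc, mon, mul_assoc, mul_assoc]
      have h1 := hpmin r hr
      rcases h1.lt_or_eq with h | h
      · rw [pow_kill k (by omega)]; simp
      · have h2 := hqmax r (by simp only [Finset.mem_filter]; exact ⟨hr, h.symm⟩)
        have h3 : r.2 = q.2 := by omega
        have h4 : r.1 < q.1 := lt_of_le_of_ne h2 fun h4 => hrq (Prod.ext h4 h3)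
        rw [h3, pow_keep, pow_kill k h4, smul_zero]
    · intro h; exact absurd hq.1 h
  have hmem : c q • (1 - Xg k * Yg k) ∈ I := by
    rw [← key]
    exact I.mul_mem_right _ _ (I.mul_mem_left _ _ haI)
  have hcq : c q ≠ 0 := Finsupp.mem_support_iff.1 hq.1
  have he : 1 - Xg k * Yg k ∈ I := by
    have := I.mul_mem_left (algebraMap k (R k) (c q)⁻¹) _ hmem
    rwa [← Algebra.smul_def, smul_smul, inv_mul_cancel₀ hcq, one_smul] at this
  rw [Fideal, TwoSidedIdeal.span_le]
  simpa using he
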